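/- For every choice of real parameters c₁, c₂, c₃, c₄, c₅, the contravariant metric on ℝ² (coordinates u¹,u²) with components g¹¹ = c₁u¹ + c₂, g¹² = g²¹ = (1/2)c₃u¹ + (1/2)c₁u² + c₅, g²² = c₃u² + c₄ is flat on the open set where det(g^{ij}) ≠ 0. -/

import Mathlib

open Matrix

/-- Partial derivative in direction `i` (0 ↦ ∂/∂u¹, 1 ↦ ∂/∂u²) of a function of
two real variables. -/
noncomputable def pd (i : Fin 2) (f : ℝ → ℝ → ℝ) (x y : ℝ) : ℝ :=
  if i = 0 then deriv (fun s => f s y) x else deriv (fun s => f x s) y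

/-- The covariant components `g_{lk}` of a contravariant metric `g`, i.e. the
entries of the inverse matrix. -/
noncomputable def covMetric (g : ℝ → ℝ → Matrix (Fin 2) (Fin 2) ℝ)
    (l k : Fin 2) (x y : ℝ) : ℝ :=
  ((g x y)⁻¹) l k

/-- Christoffel symbols `Γ^i_{jk}` of the Levi-Civita connection of the
contravariant metric `g`:
`Γ^i_{jk} = (1/2) g^{il} (∂_j g_{lk} + ∂_k g_{lj} − ∂_l g_{jk})`. -/
noncomputable def christoffel (g : ℝ → ℝ → Matrix (Fin 2) (Fin 2) ℝ)
    (i j k : Fin 2) (x y : ℝ) : ℝ :=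
  ∑ l, (1 / 2 : ℝ) * g x y i l *
    (pd j (covMetric g l k) x y + pd k (covMetric g l j) x y
      - pd l (covMetric g j k) x y)

/-- Riemann curvature tensor
`R^i_{jkl} = ∂_k Γ^i_{lj} − ∂_l Γ^i_{kj} + Γ^i_{km} Γ^m_{lj} − Γ^i_{lm} Γ^m_{kj}`. -/
noncomputable def riemann (g : ℝ → ℝ → Matrix (Fin 2) (Fin 2) ℝ)
    (i j k l : Fin 2) (x y : ℝ) : ℝ :=
  pd k (christoffel g i l j) x y - pd l (christoffel g i k j) x y
    + ∑ m, (christoffel g i k m x y * christoffel g m l j x y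
        - christoffel g i l m x y * christoffel g m k j x y)

/-- The metric of the theorem. -/
noncomputable def gM (c₁ c₂ c₃ c₄ c₅ : ℝ) : ℝ → ℝ → Matrix (Fin 2) (Fin 2) ℝ :=
  fun a b => !![c₁ * a + c₂, (1/2) * c₃ * a + (1/2) * c₁ * b + c₅;
          (1/2) * c₃ * a + (1/2) * c₁ * b + c₅, c₃ * b + c₄]

/-- Its determinant. -/
noncomputable def dM (c₁ c₂ c₃ c₄ c₅ x y : ℝ) : ℝ :=
  (c₁ * x + c₂) * (c₃ * y + c₄) - ((1/2) * c₃ * x + (1/2) * c₁ * y + c₅)^2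

/-- The adjugate. -/
noncomputable def aM (c₁ c₂ c₃ c₄ c₅ : ℝ) (i j : Fin 2) (x y : ℝ) : ℝ :=
  !![c₃ * y + c₄, -((1/2) * c₃ * x + (1/2) * c₁ * y + c₅);
     -((1/2) * c₃ * x + (1/2) * c₁ * y + c₅), c₁ * x + c₂] i j

lemma cov_eq (c₁ c₂ c₃ c₄ c₅ : ℝ) (i j : Fin 2) :
    covMetric (gM c₁ c₂ c₃ c₄ c₅) i j =
      fun x y => aM c₁ c₂ c₃ c₄ c₅ i j x y / dM c₁ c₂ c₃ c₄ c₅ x y := by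
  funext x y
  have hd : (gM c₁ c₂ c₃ c₄ c₅ x y).det = dM c₁ c₂ c₃ c₄ c₅ x y := by
    simp only [gM, dM, Matrix.det_fin_two_of]; ring
  rw [covMetric, Matrix.inv_def, hd, Ring.inverse_eq_inv', gM, Matrix.adjugate_fin_two_of,
    Matrix.smul_apply, smul_eq_mul, aM, mul_comm]
  exact (div_eq_mul_inv _ _).symm

lemma d_x (c₁ c₂ c₃ c₄ c₅ x y : ℝ) : HasDerivAt (fun s => dM c₁ c₂ c₃ c₄ c₅ s y)
    (c₁ * (c₃ * y + c₄) - c₃ * ((1/2) * c₃ * x + (1/2) * c₁ * y + c₅)) x := by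
  have h := (((hasDerivAt_id x).const_mul c₁).add_const c₂).mul_const (c₃ * y + c₄)
  have h2 := ((((hasDerivAt_id x).const_mul ((1/2) * c₃)).add_const ((1/2) * c₁ * y)).add_const
    c₅).pow 2
  refine (h.sub h2).congr_deriv ?_
  simp; ring

lemma d_y (c₁ c₂ c₃ c₄ c₅ x y : ℝ) : HasDerivAt (fun s => dM c₁ c₂ c₃ c₄ c₅ x s)
    (c₃ * (c₁ * x + c₂) - c₁ * ((1/2) * c₃ * x + (1/2) * c₁ * y + c₅)) y := by
  have h := (((hasDerivAt_id y).const_mul c₃).add_const c₄).const_mul (c₁ * x + c₂)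
  have h2 := ((((hasDerivAt_id y).const_mul ((1/2) * c₁)).const_add ((1/2) * c₃ * x)).add_const
    c₅).pow 2
  refine (h.sub h2).congr_deriv ?_
  simp; ring

lemma a_x (c₁ c₂ c₃ c₄ c₅ x y : ℝ) (i j : Fin 2) :
    HasDerivAt (fun s => aM c₁ c₂ c₃ c₄ c₅ i j s y)
    (!![0, -((1/2) * c₃); -((1/2) * c₃), c₁] i j) x := by
  have h := (((hasDerivAt_id x).const_mul c₁).add_const c₂)
  have h2 := ((((hasDerivAt_id x).const_mul ((1/2) * c₃)).add_const ((1/2) * c₁ * y)).add_const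
    c₅).neg
  fin_cases i <;> fin_cases j
  · exact hasDerivAt_const x (c₃ * y + c₄)
  · exact h2.congr_deriv (by simp)
  · exact h2.congr_deriv (by simp)
  · exact h.congr_deriv (by simp)

lemma a_y (c₁ c₂ c₃ c₄ c₅ x y : ℝ) (i j : Fin 2) :
    HasDerivAt (fun s => aM c₁ c₂ c₃ c₄ c₅ i j x s)
    (!![c₃, -((1/2) * c₁); -((1/2) * c₁), 0] i j) y := by
  have h := (((hasDerivAt_id y).const_mul c₃).add_const c₄)
  have h2 := ((((hasDerivAt_id y).const_mul ((1/2) * c₁)).const_add ((1/2) * c₃ * x)).add_const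
    c₅).neg
  fin_cases i <;> fin_cases j
  · exact h.congr_deriv (by simp)
  · exact h2.congr_deriv (by simp)
  · exact h2.congr_deriv (by simp)
  · exact hasDerivAt_const y (c₁ * x + c₂)

/-- The vector `e = (c₁, c₃) / 2`; the Christoffel symbols are `-e^i g_{jk}`. -/
noncomputable def eV (c₁ c₃ : ℝ) (i : Fin 2) : ℝ := ![c₁ / 2, c₃ / 2] i

lemma pd_cov (c₁ c₂ c₃ c₄ c₅ x y : ℝ) (hD : dM c₁ c₂ c₃ c₄ c₅ x y ≠ 0) (k l j : Fin 2) :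
    pd k (covMetric (gM c₁ c₂ c₃ c₄ c₅) l j) x y =
     -((∑ m, aM c₁ c₂ c₃ c₄ c₅ l m x y * eV c₁ c₃ m) * aM c₁ c₂ c₃ c₄ c₅ k j x y
      + (∑ m, aM c₁ c₂ c₃ c₄ c₅ j m x y * eV c₁ c₃ m) * aM c₁ c₂ c₃ c₄ c₅ k l x y)
      / dM c₁ c₂ c₃ c₄ c₅ x y ^ 2 := by
  rw [cov_eq]
  have hx := ((a_x c₁ c₂ c₃ c₄ c₅ x y l j).div (d_x c₁ c₂ c₃ c₄ c₅ x y) hD).deriv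
  have hy := ((a_y c₁ c₂ c₃ c₄ c₅ x y l j).div (d_y c₁ c₂ c₃ c₄ c₅ x y) hD).deriv
  have hk : k = 0 ∨ k = 1 := by fin_cases k <;> simp
  rcases hk with rfl | rfl
  · rw [pd, if_pos rfl]
    refine hx.trans ?_
    congr 1
    fin_cases l <;> fin_cases j <;> simp [aM, dM, eV, Fin.sum_univ_two] <;> ring
  · rw [pd, if_neg (by decide)]
    refine hy.trans ?_
    congr 1
    fin_cases l <;> fin_cases j <;> simp [aM, dM, eV, Fin.sum_univ_two] <;> ring

lemma chr_eq (c₁ c₂ c₃ c₄ c₅ x y : ℝ) (hD : dM c₁ c₂ c₃ c₄ c₅ x y ≠ 0) (i j k : Fin 2) :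
    christoffel (gM c₁ c₂ c₃ c₄ c₅) i j k x y =
      -eV c₁ c₃ i * covMetric (gM c₁ c₂ c₃ c₄ c₅) j k x y := by
  simp only [christoffel, pd_cov _ _ _ _ _ _ _ hD]
  rw [cov_eq]
  have key : ∀ t : Fin 2, ∑ l, gM c₁ c₂ c₃ c₄ c₅ x y i l * aM c₁ c₂ c₃ c₄ c₅ l t x y
      = if i = t then dM c₁ c₂ c₃ c₄ c₅ x y else 0 := by
    intro t
    fin_cases i <;> fin_cases t <;> simp [aM, dM, gM, Fin.sum_univ_two] <;> ring
  have k0 := key 0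
  have k1 := key 1
  have sym : ∀ s t : Fin 2, aM c₁ c₂ c₃ c₄ c₅ s t x y = aM c₁ c₂ c₃ c₄ c₅ t s x y := by
    intro s t
    fin_cases s <;> fin_cases t <;> simp [aM]
  have s1 := sym 1 0
  simp only [Fin.sum_univ_two] at k0 k1 ⊢
  field_simp
  generalize dM c₁ c₂ c₃ c₄ c₅ x y = D at *
  generalize gM c₁ c₂ c₃ c₄ c₅ x y = G at *
  fin_cases i <;> fin_cases j <;> fin_cases k <;> simp [s1] at k0 k1 ⊢ <;>
    generalize aM c₁ c₂ c₃ c₄ c₅ 0 0 x y = a at * <;>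
    generalize aM c₁ c₂ c₃ c₄ c₅ 0 1 x y = b at * <;>
    generalize aM c₁ c₂ c₃ c₄ c₅ 1 1 x y = c at * <;> grind

lemma pd_chr (c₁ c₂ c₃ c₄ c₅ x y : ℝ) (hD : dM c₁ c₂ c₃ c₄ c₅ x y ≠ 0) (i j k l : Fin 2) :
    pd l (christoffel (gM c₁ c₂ c₃ c₄ c₅) i j k) x y =
      -eV c₁ c₃ i * pd l (covMetric (gM c₁ c₂ c₃ c₄ c₅) j k) x y := by
  unfold pd
  split_ifs
  · rw [← deriv_const_mul_field]
    apply Filter.EventuallyEq.deriv_eq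
    filter_upwards [(d_x c₁ c₂ c₃ c₄ c₅ x y).continuousAt.eventually_ne hD] with s hs
    exact chr_eq _ _ _ _ _ _ _ hs i j k
  · rw [← deriv_const_mul_field]
    apply Filter.EventuallyEq.deriv_eq
    filter_upwards [(d_y c₁ c₂ c₃ c₄ c₅ x y).continuousAt.eventually_ne hD] with s hs
    exact chr_eq _ _ _ _ _ _ _ hs i j k

/-- **Theorem 1 of the paper (flatness part).** For every choice of the real
parameters `c₁,…,c₅`, the contravariant metric
`g¹¹ = c₁u¹ + c₂`, `g¹² = g²¹ = (1/2)c₃u¹ + (1/2)c₁u² + c₅`, `g²² = c₃u² + c₄`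
is flat at every point where it is non-degenerate. -/
theorem flat_R2_metric (c₁ c₂ c₃ c₄ c₅ : ℝ) :
    ∀ x y : ℝ,
      Matrix.det (!![c₁ * x + c₂, (1/2) * c₃ * x + (1/2) * c₁ * y + c₅;
        (1/2) * c₃ * x + (1/2) * c₁ * y + c₅, c₃ * y + c₄]) ≠ 0 →
      ∀ i j k l : Fin 2,
        riemann (fun a b => !![c₁ * a + c₂, (1/2) * c₃ * a + (1/2) * c₁ * b + c₅;
          (1/2) * c₃ * a + (1/2) * c₁ * b + c₅, c₃ * b + c₄]) i j k l x y = 0 := by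
  intro x y hdet i j k l
  have hD : dM c₁ c₂ c₃ c₄ c₅ x y ≠ 0 := by
    rw [Matrix.det_fin_two_of] at hdet
    intro h
    apply hdet
    rw [← h, dM]; ring
  change riemann (gM c₁ c₂ c₃ c₄ c₅) i j k l x y = 0
  have sym : ∀ s t : Fin 2, aM c₁ c₂ c₃ c₄ c₅ s t x y = aM c₁ c₂ c₃ c₄ c₅ t s x y := by
    intro s t
    fin_cases s <;> fin_cases t <;> simp [aM]
  simp only [riemann, pd_chr _ _ _ _ _ _ _ hD, chr_eq _ _ _ _ _ _ _ hD,
    pd_cov _ _ _ _ _ _ _ hD]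
  simp only [cov_eq, Fin.sum_univ_two]
  rw [sym l k]
  field_simp
  ring
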